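/- Let p be a prime, ψ : ℚ_p → ℂ a continuous additive character with values in the unit circle that is trivial on ℤ_p and nontrivial on p⁻¹ℤ_p, and let n = n′ + n″ with n′, n″ ≥ 1. Equip each matrix space M_{a×b}(ℚ_p) with the additive Haar measure giving M_{a×b}(ℤ_p) volume 1. For Φ : Mₙ(ℚ_p) → ℂ locally constant with compact support, set Φ̂(z) = ∫_{Mₙ(ℚ_p)} Φ(w) ψ(tr(zw)) dw, and define φ_Φ : M_{n′}(ℚ_p) × M_{n″}(ℚ_p) → ℂ by φ_Φ(x, y) = ∫_{M_{n′×n″}(ℚ_p)} Φ( [[x, u], [0, y]] ) du, where [[x, u], [0, y]] is the block upper-triangular n × n matrix. Then for all (x, y): φ_{Φ̂}(x, y) = ∫∫ φ_Φ(a, d) ψ(tr(xa) + tr(yd)) da dd, i.e., φ_{Φ̂} equals the Fourier transform of φ_Φ on M_{n′}(ℚ_p) × M_{n″}(ℚ_p) with respect to the trace pairings. -/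

import Mathlib

open MeasureTheory Matrix

noncomputable instance padicMeasurableSpace (p : ℕ) [Fact p.Prime] :
    MeasurableSpace ℚ_[p] := borel _

instance padicBorelSpace (p : ℕ) [Fact p.Prime] : BorelSpace ℚ_[p] := ⟨rfl⟩

noncomputable instance matrixPadicMeasurableSpace (p : ℕ) [Fact p.Prime]
    (m n : Type*) [Fintype m] [Fintype n] :
    MeasurableSpace (Matrix m n ℚ_[p]) := borel _

instance matrixPadicBorelSpace (p : ℕ) [Fact p.Prime]
    (m n : Type*) [Fintype m] [Fintype n] :
    BorelSpace (Matrix m n ℚ_[p]) := ⟨rfl⟩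

section MatrixBall

variable {p : ℕ} [Fact p.Prime] {m n : Type*}

/-- The closed ball of radius `r` around `0` for the sup norm on matrices. -/
def matrixBall (p : ℕ) [Fact p.Prime] (m n : Type*) (r : ℝ) : Set (Matrix m n ℚ_[p]) :=
  {A | ∀ i j, ‖A i j‖ ≤ r}

theorem isClosed_matrixBall (r : ℝ) : IsClosed (matrixBall p m n r) := by
  simp only [matrixBall, Set.ofPred_forall]
  exact isClosed_iInter fun i => isClosed_iInter fun j =>
    isClosed_le (continuous_id.matrix_elem i j).norm continuous_const

theorem add_mem_matrixBall_iff {r : ℝ} {h : Matrix m n ℚ_[p]} (hh : h ∈ matrixBall p m n r)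
    (c : Matrix m n ℚ_[p]) : c + h ∈ matrixBall p m n r ↔ c ∈ matrixBall p m n r := by
  refine ⟨fun hc i j => ?_, fun hc i j =>
    (IsUltrametricDist.norm_add_le_max _ _).trans (max_le (hc i j) (hh i j))⟩
  have := (IsUltrametricDist.norm_add_le_max ((c + h) i j) (-h i j)).trans
    (max_le (hc i j) ((norm_neg _).trans_le (hh i j)))
  simpa using this

variable [Fintype m] [Fintype n]

instance matrixPadicSecondCountable : SecondCountableTopology (Matrix m n ℚ_[p]) :=
  inferInstanceAs (SecondCountableTopology (m → n → ℚ_[p]))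

instance matrixPadicLocallyCompact : LocallyCompactSpace (Matrix m n ℚ_[p]) :=
  inferInstanceAs (LocallyCompactSpace (m → n → ℚ_[p]))

theorem exists_matrixBall_subset {s : Set (Matrix m n ℚ_[p])} (hs : s ∈ nhds 0) :
    ∃ t : ℚ_[p], t ≠ 0 ∧ matrixBall p m n ‖t‖ ⊆ s := by
  obtain ⟨ε, hε, hsub⟩ := Metric.mem_nhds_iff.1 (show s ∈ nhds (0 : m → n → ℚ_[p]) from hs)
  obtain ⟨t, ht0, ht⟩ := NormedField.exists_norm_lt ℚ_[p] hε
  have hball (f : m → n → ℚ_[p]) (hf : ∀ i j, ‖f i j‖ ≤ ‖t‖) : f ∈ Metric.ball 0 ε := by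
    rw [mem_ball_zero_iff]
    exact (pi_norm_lt_iff hε).2 fun i => (pi_norm_lt_iff hε).2 fun j => (hf i j).trans_lt ht
  exact ⟨t, norm_pos_iff.1 ht0, fun A hA => hsub (hball A hA)⟩

theorem eq_of_measure_matrixBall_one (μ ν : Measure (Matrix m n ℚ_[p]))
    [μ.IsAddHaarMeasure] [ν.IsAddHaarMeasure] (hμ : μ (matrixBall p m n 1) = 1)
    (hν : ν (matrixBall p m n 1) = 1) : μ = ν := by
  have h := Measure.isAddLeftInvariant_eq_smul μ ν
  have hc := congrArg (fun ρ => ρ (matrixBall p m n 1)) h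
  rw [Measure.smul_apply, ENNReal.smul_def, smul_eq_mul, hμ, hν, mul_one] at hc
  have hc' : Measure.addHaarScalarFactor μ ν = 1 := by exact_mod_cast hc.symm
  rw [h, hc', one_smul]

theorem measure_matrixBall_mul_inv (μ : Measure (Matrix m n ℚ_[p])) [μ.IsAddHaarMeasure]
    (hμ : μ (matrixBall p m n 1) = 1) {t : ℚ_[p]} (ht : t ≠ 0) :
    μ (matrixBall p m n ‖t‖) * μ (matrixBall p m n ‖t‖⁻¹) = 1 := by
  let e : Matrix m n ℚ_[p] ≃+ Matrix m n ℚ_[p] := DistribMulAction.toAddEquiv _ (Units.mk0 t ht)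
  have he : ⇑e = fun A => t • A := rfl
  have he' : ⇑e.symm = fun A => t⁻¹ • A := rfl
  have hec : Continuous e := he ▸ continuous_const_smul t
  have hec' : Continuous e.symm := he' ▸ continuous_const_smul t⁻¹
  have : (μ.map e).IsAddHaarMeasure := e.isAddHaarMeasure_map μ hec hec'
  have h := Measure.isAddLeftInvariant_eq_smul (μ.map e) μ
  have key (r : ℝ) : μ (matrixBall p m n (‖t‖⁻¹ * r)) =
      Measure.addHaarScalarFactor (μ.map e) μ * μ (matrixBall p m n r) := by
    have := congrArg (fun ρ => ρ (matrixBall p m n r)) h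
    simp only [Measure.map_apply hec.measurable (isClosed_matrixBall r).measurableSet,
      Measure.smul_apply, ENNReal.smul_def, smul_eq_mul] at this
    rw [← this]
    congr 1
    ext A
    simp [matrixBall, he, ← div_eq_inv_mul, le_div_iff₀' (norm_pos_iff.2 ht)]
  have h1 := key 1
  have h2 := key ‖t‖
  rw [inv_mul_cancel₀ (norm_ne_zero_iff.2 ht), hμ] at h2
  rw [mul_one, hμ, mul_one] at h1
  rw [h1, mul_comm, ← h2]

/-- A locally constant compactly supported function is invariant under a small matrix ball. -/
theorem exists_matrixBall_invariant {Φ : Matrix m n ℚ_[p] → ℂ}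
    (hΦ : IsLocallyConstant Φ) (hΦc : HasCompactSupport Φ) :
    ∃ t : ℚ_[p], t ≠ 0 ∧ ∀ h ∈ matrixBall p m n ‖t‖, ∀ w, Φ (w + h) = Φ w := by
  have hev : ∀ᶠ h in nhds (0 : Matrix m n ℚ_[p]), ∀ w ∈ tsupport Φ, Φ (w + h) = Φ w := by
    refine hΦc.isCompact.eventually_forall_of_forall_eventually fun w _ => ?_
    have hw := (IsLocallyConstant.iff_eventually_eq Φ).1 hΦ w
    have h1 : Filter.Tendsto (fun z : Matrix m n ℚ_[p] × Matrix m n ℚ_[p] => z.2 + z.1)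
        (nhds (0, w)) (nhds w) := by
      have : Continuous fun z : Matrix m n ℚ_[p] × Matrix m n ℚ_[p] => z.2 + z.1 := by fun_prop
      simpa using this.tendsto (0, w)
    filter_upwards [h1.eventually hw, (continuous_snd.tendsto (0, w)).eventually hw]
      with z hz hz'
    rw [hz, hz']
  have hneg : Filter.Tendsto (fun h : Matrix m n ℚ_[p] => -h) (nhds 0) (nhds 0) := by
    simpa using (continuous_neg (G := Matrix m n ℚ_[p])).tendsto 0
  obtain ⟨t, ht, hsub⟩ := exists_matrixBall_subset (hev.and (hneg.eventually hev))
  refine ⟨t, ht, fun h hh w => ?_⟩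
  obtain ⟨hp, hm⟩ := hsub hh
  by_cases hw : w ∈ tsupport Φ
  · exact hp w hw
  by_cases hwh : w + h ∈ tsupport Φ
  · simpa using (hm _ hwh).symm
  · rw [image_eq_zero_of_notMem_tsupport hw, image_eq_zero_of_notMem_tsupport hwh]

end MatrixBall

section FourierInversion

variable {p : ℕ} [Fact p.Prime] {m n : Type*} [Fintype m] [Fintype n] {ψ : ℚ_[p] → ℂ}

theorem exists_mem_matrixBall_trace_ne_one
    (hψnontriv : ∃ x : ℚ_[p], ‖x‖ ≤ p ∧ ψ x ≠ 1) {t : ℚ_[p]} (ht : t ≠ 0)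
    {A : Matrix m n ℚ_[p]} (hA : A ∉ matrixBall p m n ‖t‖⁻¹) :
    ∃ h ∈ matrixBall p n m ‖t‖, ψ (A * h).trace ≠ 1 := by
  classical
  obtain ⟨x, hx, hψx⟩ := hψnontriv
  simp only [matrixBall, Set.mem_ofPred_eq, not_forall, not_le] at hA
  obtain ⟨i, j, hij⟩ := hA
  have ht' : 0 < ‖t‖ := norm_pos_iff.2 ht
  have hA0 : A i j ≠ 0 := norm_pos_iff.1 ((inv_pos.2 ht').trans hij)
  have h1 : (p : ℝ) ≤ ‖A i j * t‖ := by
    have := Padic.norm_le_pow_iff_norm_lt_pow_add_one (A i j * t) 0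
    rw [zero_add, zpow_zero, zpow_one] at this
    refine le_of_not_gt fun hlt => absurd (this.2 hlt) (not_le.2 ?_)
    rw [norm_mul]
    exact (inv_lt_iff_one_lt_mul₀ ht').1 hij
  refine ⟨Matrix.single j i (x / A i j), fun k l => ?_, ?_⟩
  · rw [Matrix.single_apply]
    split_ifs
    · rw [norm_div, div_le_iff₀ (norm_pos_iff.2 hA0), mul_comm, ← norm_mul]
      exact hx.trans h1
    · simp
  · rwa [Matrix.trace_mul_single, op_smul_eq_mul, mul_div_cancel₀ _ hA0]

theorem integral_mul_trace_eq_zero (hψadd : ∀ x y, ψ (x + y) = ψ x * ψ y)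
    (μ : Measure (Matrix m n ℚ_[p])) [μ.IsAddHaarMeasure] {F : Matrix m n ℚ_[p] → ℂ}
    {A : Matrix n m ℚ_[p]} {h : Matrix m n ℚ_[p]} (hF : ∀ c, F (c + h) = F c)
    (hA : ψ (A * h).trace ≠ 1) : ∫ c, F c * ψ (A * c).trace ∂μ = 0 := by
  have h1 := integral_add_right_eq_self (μ := μ) (fun c => F c * ψ (A * c).trace) h
  simp only [hF, Matrix.mul_add, Matrix.trace_add, hψadd, ← mul_assoc] at h1
  rw [integral_mul_const] at h1
  by_contra h0
  exact hA (mul_left_cancel₀ h0 (h1.trans (mul_one _).symm))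

theorem norm_trace_mul_le_one {t : ℚ_[p]} (ht : t ≠ 0) {u : Matrix n m ℚ_[p]}
    {c : Matrix m n ℚ_[p]} (hu : u ∈ matrixBall p n m ‖t‖⁻¹) (hc : c ∈ matrixBall p m n ‖t‖) :
    ‖(u * c).trace‖ ≤ 1 := by
  refine IsUltrametricDist.norm_sum_le_of_forall_le_of_nonneg zero_le_one fun i _ =>
    IsUltrametricDist.norm_sum_le_of_forall_le_of_nonneg zero_le_one fun j _ => ?_
  rw [norm_mul]
  exact (mul_le_mul (hu i j) (hc j i) (norm_nonneg _) (by positivity)).trans_eq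
    (inv_mul_cancel₀ (norm_ne_zero_iff.2 ht))

/-- Fourier inversion at `0` on a space of matrices. -/
theorem integral_integral_mul_trace (hψcont : Continuous ψ) (hψnorm : ∀ x, ‖ψ x‖ = 1)
    (hψadd : ∀ x y, ψ (x + y) = ψ x * ψ y)
    (hψtriv : ∀ x : ℚ_[p], ‖x‖ ≤ 1 → ψ x = 1)
    (hψnontriv : ∃ x : ℚ_[p], ‖x‖ ≤ p ∧ ψ x ≠ 1)
    (μ : Measure (Matrix m n ℚ_[p])) [μ.IsAddHaarMeasure]
    (ν : Measure (Matrix n m ℚ_[p])) [ν.IsAddHaarMeasure] {t : ℚ_[p]} (ht : t ≠ 0)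
    (hμν : μ (matrixBall p m n ‖t‖) * ν (matrixBall p n m ‖t‖⁻¹) = 1)
    {F : Matrix m n ℚ_[p] → ℂ} (hFint : Integrable F μ)
    (hF : ∀ h ∈ matrixBall p m n ‖t‖, ∀ c, F (c + h) = F c) :
    ∫ u, ∫ c, F c * ψ (u * c).trace ∂μ ∂ν = F 0 := by
  set B := matrixBall p n m ‖t‖⁻¹
  set B' := matrixBall p m n ‖t‖
  have hBm : MeasurableSet B := (isClosed_matrixBall _).measurableSet
  have hB'm : MeasurableSet B' := (isClosed_matrixBall _).measurableSet
  have hνB : ν B ≠ ⊤ := by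
    intro h
    rw [h] at hμν
    by_cases h0 : μ B' = 0 <;> simp [h0] at hμν
  have : IsFiniteMeasure (ν.restrict B) := isFiniteMeasure_restrict.2 hνB
  have hsupp (u : Matrix n m ℚ_[p]) (hu : u ∉ B) : ∫ c, F c * ψ (u * c).trace ∂μ = 0 := by
    obtain ⟨h, hh, hψh⟩ := exists_mem_matrixBall_trace_ne_one hψnontriv ht hu
    exact integral_mul_trace_eq_zero hψadd μ (hF h hh) hψh
  have hinner (c : Matrix m n ℚ_[p]) :
      ∫ u in B, F c * ψ (u * c).trace ∂ν = B'.indicator (fun _ => F 0 * ν.real B) c := by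
    rw [integral_const_mul]
    by_cases hc : c ∈ B'
    · have h1 : ∫ u in B, ψ (u * c).trace ∂ν = ∫ u in B, 1 ∂ν :=
        setIntegral_congr_fun hBm fun u hu => hψtriv _ (norm_trace_mul_le_one ht hu hc)
      have h2 := hF c hc 0
      rw [zero_add] at h2
      simp [h1, hc, h2]
    · have hc' : c ∉ matrixBall p m n ‖t⁻¹‖⁻¹ := by simpa using hc
      obtain ⟨h, hh, hψh⟩ := exists_mem_matrixBall_trace_ne_one hψnontriv (inv_ne_zero ht) hc'
      rw [norm_inv] at hh
      have hind (u : Matrix n m ℚ_[p]) :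
          B.indicator (fun _ => (1 : ℂ)) (u + h) = B.indicator (fun _ => 1) u := by
        have hu : u + h ∈ B ↔ u ∈ B := add_mem_matrixBall_iff hh u
        by_cases hu' : u ∈ B
        · rw [Set.indicator_of_mem hu', Set.indicator_of_mem (hu.2 hu')]
        · rw [Set.indicator_of_notMem hu', Set.indicator_of_notMem (mt hu.1 hu')]
      have h0 := integral_mul_trace_eq_zero hψadd ν hind hψh
      rw [Set.indicator_of_notMem hc, ← integral_indicator hBm]
      convert mul_zero (F c) using 2
      rw [← h0]
      congr 1 with u
      by_cases hu : u ∈ B <;> simp [hu, Matrix.trace_mul_comm u c]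
  have hint : Integrable (Function.uncurry fun u c => F c * ψ (u * c).trace)
      ((ν.restrict B).prod μ) := by
    refine (hFint.comp_snd (ν.restrict B)).mul_bdd (c := 1) ?_ ?_
    · exact Continuous.aestronglyMeasurable (by fun_prop)
    · exact .of_forall fun _ => (hψnorm _).le
  rw [← setIntegral_eq_integral_of_forall_compl_eq_zero hsupp, integral_integral_swap hint]
  simp only [hinner]
  rw [integral_indicator hB'm, setIntegral_const, Complex.real_smul, mul_left_comm,
    ← Complex.ofReal_mul, measureReal_def, measureReal_def, ← ENNReal.toReal_mul, hμν]
  simp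

end FourierInversion

section Blocks

variable {p : ℕ} [Fact p.Prime] {m n : Type*}

/-- Assembling a block matrix, with the lower left block first, then the two diagonal blocks. -/
def fromBlocksAddEquiv (p : ℕ) [Fact p.Prime] (m n : Type*) :
    Matrix n m ℚ_[p] × Matrix m m ℚ_[p] × Matrix n n ℚ_[p] × Matrix m n ℚ_[p] ≃+
      Matrix (m ⊕ n) (m ⊕ n) ℚ_[p] where
  toFun z := Matrix.fromBlocks z.2.1 z.2.2.2 z.1 z.2.2.1
  invFun w := (w.toBlocks₂₁, w.toBlocks₁₁, w.toBlocks₂₂, w.toBlocks₁₂)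
  left_inv _ := rfl
  right_inv w := Matrix.fromBlocks_toBlocks w
  map_add' _ _ := (Matrix.fromBlocks_add ..).symm

@[simp]
theorem fromBlocksAddEquiv_apply
    (z : Matrix n m ℚ_[p] × Matrix m m ℚ_[p] × Matrix n n ℚ_[p] × Matrix m n ℚ_[p]) :
    fromBlocksAddEquiv p m n z = Matrix.fromBlocks z.2.1 z.2.2.2 z.1 z.2.2.1 :=
  rfl

theorem continuous_fromBlocksAddEquiv : Continuous (fromBlocksAddEquiv p m n) :=
  continuous_snd.fst.matrix_fromBlocks continuous_snd.snd.snd continuous_fst continuous_snd.snd.fst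

theorem continuous_fromBlocksAddEquiv_symm : Continuous (fromBlocksAddEquiv p m n).symm :=
  (continuous_id.matrix_submatrix Sum.inr Sum.inl).prodMk <|
    (continuous_id.matrix_submatrix Sum.inl Sum.inl).prodMk <|
      (continuous_id.matrix_submatrix Sum.inr Sum.inr).prodMk <|
        continuous_id.matrix_submatrix Sum.inl Sum.inr

variable [Fintype m] [Fintype n]

theorem trace_fromBlocks {R : Type*} [AddCommMonoid R] (A : Matrix m m R) (B : Matrix m n R)
    (C : Matrix n m R) (D : Matrix n n R) :
    (Matrix.fromBlocks A B C D).trace = A.trace + D.trace := by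
  simp [Matrix.trace, Fintype.sum_sum_type]

theorem map_fromBlocksAddEquiv_prod (μ : Measure (Matrix (m ⊕ n) (m ⊕ n) ℚ_[p]))
    [μ.IsAddHaarMeasure] (hμ : μ (matrixBall p (m ⊕ n) (m ⊕ n) 1) = 1)
    (μ₁₁ : Measure (Matrix m m ℚ_[p])) [μ₁₁.IsAddHaarMeasure] (hμ₁₁ : μ₁₁ (matrixBall p m m 1) = 1)
    (μ₁₂ : Measure (Matrix m n ℚ_[p])) [μ₁₂.IsAddHaarMeasure] (hμ₁₂ : μ₁₂ (matrixBall p m n 1) = 1)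
    (μ₂₁ : Measure (Matrix n m ℚ_[p])) [μ₂₁.IsAddHaarMeasure] (hμ₂₁ : μ₂₁ (matrixBall p n m 1) = 1)
    (μ₂₂ : Measure (Matrix n n ℚ_[p])) [μ₂₂.IsAddHaarMeasure]
    (hμ₂₂ : μ₂₂ (matrixBall p n n 1) = 1) :
    (μ₂₁.prod (μ₁₁.prod (μ₂₂.prod μ₁₂))).map (fromBlocksAddEquiv p m n) = μ := by
  have h₃ : (μ₁₁.prod (μ₂₂.prod μ₁₂)).IsAddHaarMeasure := Measure.prod.instIsAddHaarMeasure _ _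
  have h₄ : (μ₂₁.prod (μ₁₁.prod (μ₂₂.prod μ₁₂))).IsAddHaarMeasure :=
    Measure.prod.instIsAddHaarMeasure _ _
  have := (fromBlocksAddEquiv p m n).isAddHaarMeasure_map (μ₂₁.prod (μ₁₁.prod (μ₂₂.prod μ₁₂)))
    continuous_fromBlocksAddEquiv continuous_fromBlocksAddEquiv_symm
  refine eq_of_measure_matrixBall_one _ _ ?_ hμ
  have hpre : fromBlocksAddEquiv p m n ⁻¹' matrixBall p (m ⊕ n) (m ⊕ n) 1 =
      matrixBall p n m 1 ×ˢ matrixBall p m m 1 ×ˢ matrixBall p n n 1 ×ˢ matrixBall p m n 1 := by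
    ext z
    simp only [matrixBall, Set.mem_preimage, Set.mem_ofPred_eq, Set.mem_prod,
      fromBlocksAddEquiv_apply, Sum.forall, Matrix.fromBlocks_apply₁₁,
      Matrix.fromBlocks_apply₁₂, Matrix.fromBlocks_apply₂₁, Matrix.fromBlocks_apply₂₂, forall_and]
    tauto
  rw [Measure.map_apply continuous_fromBlocksAddEquiv.measurable
    (isClosed_matrixBall _).measurableSet, hpre]
  simp [Measure.prod_prod, hμ₁₁, hμ₁₂, hμ₂₁, hμ₂₂]

theorem trace_fromBlocks_mul_fromBlocksAddEquiv (x : Matrix m m ℚ_[p]) (u : Matrix m n ℚ_[p])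
    (y : Matrix n n ℚ_[p])
    (z : Matrix n m ℚ_[p] × Matrix m m ℚ_[p] × Matrix n n ℚ_[p] × Matrix m n ℚ_[p]) :
    (Matrix.fromBlocks x u 0 y * fromBlocksAddEquiv p m n z).trace =
      ((x * z.2.1).trace + (y * z.2.2.1).trace) + (u * z.1).trace := by
  simp only [fromBlocksAddEquiv_apply, Matrix.fromBlocks_multiply, trace_fromBlocks,
    Matrix.trace_add, Matrix.zero_mul, zero_add]
  ring

theorem map_transpose_isAddHaarMeasure (μ : Measure (Matrix m n ℚ_[p])) [μ.IsAddHaarMeasure] :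
    (μ.map Matrix.transpose).IsAddHaarMeasure :=
  (Matrix.transposeAddEquiv m n ℚ_[p]).isAddHaarMeasure_map μ
    continuous_id.matrix_transpose continuous_id.matrix_transpose

theorem map_transpose_matrixBall (μ : Measure (Matrix m n ℚ_[p])) (r : ℝ) :
    μ.map Matrix.transpose (matrixBall p n m r) = μ (matrixBall p m n r) := by
  have hcont : Continuous (Matrix.transpose : Matrix m n ℚ_[p] → Matrix n m ℚ_[p]) :=
    continuous_id.matrix_transpose
  rw [Measure.map_apply hcont.measurable (isClosed_matrixBall _).measurableSet]
  congr 1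
  ext A
  exact forall_comm

end Blocks

/-- Godement–Jacquet Lemma 3.4.0: the partial-integration (Harish-Chandra–type) transform
`φ_Φ(x, y) = ∫ Φ([[x,u],[0,y]]) du` intertwines the Fourier transform on `Mₙ(ℚ_p)` with
the Fourier transform on `M_{n′}(ℚ_p) × M_{n″}(ℚ_p)`: `φ_{Φ̂} = (φ_Φ)^∧`. -/
theorem godement_jacquet_commutativity (p : ℕ) [Fact p.Prime] (n' n'' : ℕ)
    (hn' : 1 ≤ n') (hn'' : 1 ≤ n'')
    (ψ : ℚ_[p] → ℂ) (hψcont : Continuous ψ) (hψnorm : ∀ x, ‖ψ x‖ = 1)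
    (hψadd : ∀ x y, ψ (x + y) = ψ x * ψ y)
    (hψtriv : ∀ x : ℚ_[p], ‖x‖ ≤ 1 → ψ x = 1)
    (hψnontriv : ∃ x : ℚ_[p], ‖x‖ ≤ p ∧ ψ x ≠ 1)
    (μfull : Measure (Matrix (Fin n' ⊕ Fin n'') (Fin n' ⊕ Fin n'') ℚ_[p]))
    [μfull.IsAddHaarMeasure]
    (hμfull : μfull {A | ∀ i j, ‖A i j‖ ≤ 1} = 1)
    (μ₁ : Measure (Matrix (Fin n') (Fin n') ℚ_[p])) [μ₁.IsAddHaarMeasure]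
    (hμ₁ : μ₁ {A | ∀ i j, ‖A i j‖ ≤ 1} = 1)
    (μ₂ : Measure (Matrix (Fin n'') (Fin n'') ℚ_[p])) [μ₂.IsAddHaarMeasure]
    (hμ₂ : μ₂ {A | ∀ i j, ‖A i j‖ ≤ 1} = 1)
    (μN : Measure (Matrix (Fin n') (Fin n'') ℚ_[p])) [μN.IsAddHaarMeasure]
    (hμN : μN {A | ∀ i j, ‖A i j‖ ≤ 1} = 1)
    (Φ : Matrix (Fin n' ⊕ Fin n'') (Fin n' ⊕ Fin n'') ℚ_[p] → ℂ)
    (hΦlc : IsLocallyConstant Φ) (hΦc : HasCompactSupport Φ) :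
    ∀ (x : Matrix (Fin n') (Fin n') ℚ_[p]) (y : Matrix (Fin n'') (Fin n'') ℚ_[p]),
      (∫ u, (∫ w, Φ w * ψ ((Matrix.fromBlocks x u 0 y * w).trace) ∂μfull) ∂μN) =
        ∫ a, ∫ d,
          (∫ u, Φ (Matrix.fromBlocks a u 0 d) ∂μN) *
            ψ ((x * a).trace + (y * d).trace) ∂μ₂ ∂μ₁ := by
  intro x y
  let E := fromBlocksAddEquiv p (Fin n') (Fin n'')
  have hE : Continuous E := continuous_fromBlocksAddEquiv
  let e : _ ≃ₜ Matrix (Fin n' ⊕ Fin n'') (Fin n' ⊕ Fin n'') ℚ_[p] :=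
    ⟨E.toEquiv, hE, continuous_fromBlocksAddEquiv_symm⟩
  let μV := μN.map Matrix.transpose
  have : μV.IsAddHaarMeasure := map_transpose_isAddHaarMeasure μN
  have hμV : μV (matrixBall p (Fin n'') (Fin n') 1) = 1 :=
    (map_transpose_matrixBall μN 1).trans hμN
  obtain ⟨t, ht, hinv⟩ := exists_matrixBall_invariant hΦlc hΦc
  have hμVN : μV (matrixBall p (Fin n'') (Fin n') ‖t‖) *
      μN (matrixBall p (Fin n') (Fin n'') ‖t‖⁻¹) = 1 :=
    map_transpose_matrixBall μN ‖t‖ ▸ measure_matrixBall_mul_inv μN hμN ht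
  let ρ := μ₁.prod (μ₂.prod μN)
  have hmap : (μV.prod ρ).map E = μfull :=
    map_fromBlocksAddEquiv_prod μfull hμfull μ₁ hμ₁ μN hμN μV hμV μ₂ hμ₂
  have hΦcont : Continuous Φ := hΦlc.continuous
  have hΦE : HasCompactSupport (Φ ∘ E) := hΦc.comp_homeomorph e
  let f : Matrix (Fin n'') (Fin n') ℚ_[p] × Matrix (Fin n') (Fin n') ℚ_[p] ×
      Matrix (Fin n'') (Fin n'') ℚ_[p] × Matrix (Fin n') (Fin n'') ℚ_[p] → ℂ :=
    fun z => Φ (E z) * ψ ((x * z.2.1).trace + (y * z.2.2.1).trace)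
  have hfcont : Continuous f := by
    have := hΦcont.comp hE
    unfold f
    fun_prop
  have hfc : HasCompactSupport f := hΦE.mul_right
  have hfint : Integrable f (μV.prod ρ) := hfcont.integrable_of_hasCompactSupport hfc
  have hf0c : HasCompactSupport fun q => f (0, q) :=
    HasCompactSupport.intro (hfc.isCompact.image continuous_snd) fun q hq =>
      image_eq_zero_of_notMem_tsupport fun hmem => hq ⟨_, hmem, rfl⟩
  have hf0cont : Continuous fun q => f (0, q) := by fun_prop
  have hf0 : Integrable (fun q => f (0, q)) ρ := hf0cont.integrable_of_hasCompactSupport hf0c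
  have hfinv (h) (hh : h ∈ matrixBall p (Fin n'') (Fin n') ‖t‖) (c) :
      ∫ q, f (c + h, q) ∂ρ = ∫ q, f (c, q) ∂ρ := by
    refine integral_congr_ae (.of_forall fun q => ?_)
    have hball : E (h, 0) ∈ matrixBall p (Fin n' ⊕ Fin n'') (Fin n' ⊕ Fin n'') ‖t‖ := by
      rintro (i | i) (j | j)
      · simp [E]
      · simp [E]
      · exact hh i j
      · simp [E]
    have := hinv _ hball (E (c, q))
    rw [← map_add, Prod.mk_add_mk, add_zero] at this
    simp only [f, this]
  have hinner (u : Matrix (Fin n') (Fin n'') ℚ_[p]) :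
      ∫ w, Φ w * ψ ((Matrix.fromBlocks x u 0 y * w).trace) ∂μfull =
        ∫ c, (∫ q, f (c, q) ∂ρ) * ψ (u * c).trace ∂μV := by
    rw [← hmap]
    refine (e.toMeasurableEquiv.measurableEmbedding.integral_map _).trans ?_
    have hint : Integrable (fun z => f z * ψ (u * z.1).trace) (μV.prod ρ) :=
      hfint.mul_bdd (c := 1) (Continuous.aestronglyMeasurable (by fun_prop))
        (.of_forall fun _ => (hψnorm _).le)
    simp only [← integral_mul_const]
    rw [← integral_prod _ hint]
    refine integral_congr_ae (.of_forall fun z => ?_)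
    change Φ (E z) * ψ (Matrix.fromBlocks x u 0 y * E z).trace = _
    rw [trace_fromBlocks_mul_fromBlocksAddEquiv, hψadd _ (u * z.1).trace, ← mul_assoc]
  simp only [hinner]
  rw [integral_integral_mul_trace hψcont hψnorm hψadd hψtriv hψnontriv μV μN ht hμVN
    hfint.integral_prod_left hfinv, integral_prod _ hf0]
  refine integral_congr_ae ?_
  filter_upwards [hf0.prod_right_ae] with a ha
  rw [integral_prod _ ha]
  simp only [f, integral_mul_const]
  rfl
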